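/- arXiv:quant-ph/0412116 — 2 statements merged into one kernel-verified Lean document; each statement's English description precedes it below -/
import Mathlib

section
/- Generalized Schumacher–Westmoreland–Wootters inequality (discrete, finite-dimensional form of the paper's main inequality (3.28)): χ{p, ρ} ≥ I_c + Σ_{ω : P_f(ω) > 0} P_f(ω)·χ{P_{i|f}(·|ω), ρ_f^•(ω)}, where for each ω with P_f(ω) > 0 one sets χ{P_{i|f}(·|ω), ρ_f^•(ω)} := Σ_{α : p(α,ω) > 0} P_{i|f}(α|ω)·S(ρ_f^α(ω)|ρ_f(ω)). (This is well defined since Σ_α p(α,ω)·ρ_f^α(ω) = P_f(ω)·ρ_f(ω), so ρ_f(ω) is the barycenter of the posterior ensemble.) -/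
open Matrix BigOperators
open scoped Kronecker ComplexOrder

noncomputable section

/-- A density matrix: positive semidefinite with unit trace. -/
def IsDensityMatrix {ι : Type*} [Fintype ι] (ρ : Matrix ι ι ℂ) : Prop :=
  ρ.PosSemidef ∧ ρ.trace = 1

/-- von Neumann entropy (natural logarithm), via the eigenvalues;
junk value `0` if the matrix is not Hermitian. -/
noncomputable def vnEntropy {ι : Type*} [Fintype ι] [DecidableEq ι]
    (ρ : Matrix ι ι ℂ) : ℝ :=
  if h : ρ.IsHermitian then -∑ i, h.eigenvalues i * Real.log (h.eigenvalues i) else 0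

/-- Quantum relative entropy `S(σ|τ)` (natural logarithm), computed in an orthonormal
eigenbasis of `τ`; junk value `0` if `σ` or `τ` is not Hermitian. -/
noncomputable def relEnt {ι : Type*} [Fintype ι] [DecidableEq ι]
    (σ τ : Matrix ι ι ℂ) : ℝ :=
  if h : σ.IsHermitian ∧ τ.IsHermitian then
    (∑ i, h.1.eigenvalues i * Real.log (h.1.eigenvalues i))
      - ∑ j, (if 0 < h.2.eigenvalues j then
          Real.log (h.2.eigenvalues j) *
            ((star (fun i => h.2.eigenvectorBasis j i)) ⬝ᵥ
              σ.mulVec (fun i => h.2.eigenvectorBasis j i)).re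
        else 0)
  else 0

/-- Holevo χ-quantity of an ensemble of states, relative to its barycenter. -/
noncomputable def holevoChi {ι B : Type*} [Fintype ι] [DecidableEq ι] [Fintype B]
    (q : B → ℝ) (τ : B → Matrix ι ι ℂ) : ℝ :=
  ∑ β, if 0 < q β then q β * relEnt (τ β) (∑ γ, q γ • τ γ) else 0

/-- The action of an instrument in Kraus form: `I_ω(ρ) = ∑ k, V ω k * ρ * (V ω k)ᴴ`. -/
noncomputable def instAct {n m : ℕ} {Ω K : Type*} [Fintype K]
    (V : Ω → K → Matrix (Fin m) (Fin n) ℂ) (ω : Ω)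
    (ρ : Matrix (Fin n) (Fin n) ℂ) : Matrix (Fin m) (Fin m) ℂ :=
  ∑ k, V ω k * ρ * (V ω k)ᴴ

/-- The POVM associated with an instrument in Kraus form: `E_ω = ∑ k, (V ω k)ᴴ * V ω k`. -/
noncomputable def povm {n m : ℕ} {Ω K : Type*} [Fintype K]
    (V : Ω → K → Matrix (Fin m) (Fin n) ℂ) (ω : Ω) : Matrix (Fin n) (Fin n) ℂ :=
  ∑ k, (V ω k)ᴴ * V ω k

/-- Outcome probability `Tr(E_ω ρ)`. -/
noncomputable def probOut {n m : ℕ} {Ω K : Type*} [Fintype K]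
    (V : Ω → K → Matrix (Fin m) (Fin n) ℂ) (ρ : Matrix (Fin n) (Fin n) ℂ) (ω : Ω) : ℝ :=
  ((povm V ω * ρ).trace).re

/-- The a posteriori state `π_ρ(ω) = I_ω(ρ)/Tr(I_ω(ρ))` (junk if the trace vanishes). -/
noncomputable def post {n m : ℕ} {Ω K : Type*} [Fintype K]
    (V : Ω → K → Matrix (Fin m) (Fin n) ℂ) (ω : Ω)
    (ρ : Matrix (Fin n) (Fin n) ℂ) : Matrix (Fin m) (Fin m) ℂ :=
  (((instAct V ω ρ).trace.re)⁻¹ : ℝ) • instAct V ω ρ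

/-- The classical (Shannon) input/output mutual information of the ensemble `(p, ρ)`
measured with the POVM of the instrument `V`. -/
noncomputable def Ic {n m : ℕ} {A Ω K : Type*} [Fintype A] [Fintype Ω] [Fintype K]
    (p : A → ℝ) (ρ : A → Matrix (Fin n) (Fin n) ℂ)
    (V : Ω → K → Matrix (Fin m) (Fin n) ℂ) : ℝ :=
  ∑ α, ∑ ω,
    if 0 < p α * probOut V (ρ α) ω then
      p α * probOut V (ρ α) ω *
        Real.log ((p α * probOut V (ρ α) ω) /
          (p α * probOut V (∑ β, p β • ρ β) ω))
    else 0

/-- Quantum information gain of the instrument `V` at the state `ρ`. -/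
noncomputable def infoGain {n m : ℕ} {Ω K : Type*} [Fintype Ω] [Fintype K]
    (V : Ω → K → Matrix (Fin m) (Fin n) ℂ) (ρ : Matrix (Fin n) (Fin n) ℂ) : ℝ :=
  vnEntropy ρ - ∑ ω, if 0 < (instAct V ω ρ).trace.re then
    (instAct V ω ρ).trace.re * vnEntropy (post V ω ρ) else 0

/-- A unitary diagonalization of a positive semidefinite matrix. -/
structure IsSpectralDecomp {ι : Type*} [Fintype ι] [DecidableEq ι]
    (A U : Matrix ι ι ℂ) (a : ι → ℝ) : Prop where
  unitary : U ∈ unitaryGroup ι ℂ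
  nonneg : ∀ i, 0 ≤ a i
  eq : A = U * diagonal (fun i => (a i : ℂ)) * Uᴴ

/-- Squared moduli of the overlaps of two unitary bases. -/
def overlap {ι : Type*} [Fintype ι] (U W : Matrix ι ι ℂ) (i j : ι) : ℝ :=
  Complex.normSq ((Wᴴ * U) j i)

/-- The relative entropy expressed through spectral data. -/
def spectralRelEnt {ι : Type*} [Fintype ι] (U : Matrix ι ι ℂ) (a : ι → ℝ)
    (W : Matrix ι ι ℂ) (b : ι → ℝ) : ℝ :=
  ∑ i, ∑ j, overlap U W i j * (a i * (Real.log (a i) - Real.log (b j)))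

/-- The concave functional of `X` whose supremum is `⟪ρ, (L_σ + t R_ρ)⁻¹ ρ⟫`. -/
def resolventForm {ι : Type*} [Fintype ι] (t : ℝ) (ρ σ X : Matrix ι ι ℂ) : ℝ :=
  2 * (Xᴴ * ρ).trace.re - (Xᴴ * σ * X).trace.re - t * (X * ρ * Xᴴ).trace.re

/-- The value of the supremum of `resolventForm` in terms of spectral data. -/
def resolventSum {ι : Type*} [Fintype ι] (U : Matrix ι ι ℂ) (a : ι → ℝ)
    (W : Matrix ι ι ℂ) (b : ι → ℝ) (t : ℝ) : ℝ :=
  ∑ i, ∑ j, overlap U W i j * (a i ^ 2 / (b j + t * a i))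

lemma overlap_nonneg {ι : Type*} [Fintype ι] (U W : Matrix ι ι ℂ) (i j : ι) : 0 ≤ overlap U W i j :=
  Complex.normSq_nonneg _

section

variable {ι : Type*} [Fintype ι] [DecidableEq ι]

lemma trace_mul_diagonal_mul_conjTranspose (Z : Matrix ι ι ℂ) (a : ι → ℝ) :
    (Z * diagonal (fun i => (a i : ℂ)) * Zᴴ).trace.re =
      ∑ i, ∑ j, a i * Complex.normSq (Z j i) := by
  rw [Finset.sum_comm, trace, Complex.re_sum]
  refine Finset.sum_congr rfl fun j _ => ?_
  rw [diag_apply, mul_apply, Complex.re_sum]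
  refine Finset.sum_congr rfl fun i _ => ?_
  rw [mul_diagonal, conjTranspose_apply]
  simp [Complex.normSq_apply]
  ring

lemma trace_conjTranspose_mul_diagonal_mul (Z : Matrix ι ι ℂ) (b : ι → ℝ) :
    (Zᴴ * diagonal (fun i => (b i : ℂ)) * Z).trace.re =
      ∑ i, ∑ j, b j * Complex.normSq (Z j i) := by
  have h := trace_mul_diagonal_mul_conjTranspose Zᴴ b
  rw [conjTranspose_conjTranspose] at h
  rw [h, Finset.sum_comm]
  simp [conjTranspose_apply]

lemma conjTranspose_mul_self_of_mem_unitaryGroup {U : Matrix ι ι ℂ}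
    (hU : U ∈ unitaryGroup ι ℂ) : Uᴴ * U = 1 :=
  (mem_unitaryGroup_iff').mp hU

lemma self_mul_conjTranspose_of_mem_unitaryGroup {U : Matrix ι ι ℂ}
    (hU : U ∈ unitaryGroup ι ℂ) : U * Uᴴ = 1 :=
  (mem_unitaryGroup_iff).mp hU

lemma resolventForm_eq {ρ σ U W : Matrix ι ι ℂ} {a b : ι → ℝ}
    (hρ : IsSpectralDecomp ρ U a) (hσ : IsSpectralDecomp σ W b) (t : ℝ) (Z : Matrix ι ι ℂ) :
    resolventForm t ρ σ (W * Z * Uᴴ) = ∑ i, ∑ j,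
      (2 * (a i * (star (Z j i) * (Wᴴ * U) j i).re)
        - (b j + t * a i) * Complex.normSq (Z j i)) := by
  have hU := conjTranspose_mul_self_of_mem_unitaryGroup hρ.unitary
  have hW := conjTranspose_mul_self_of_mem_unitaryGroup hσ.unitary
  have h₁ : ((W * Z * Uᴴ)ᴴ * ρ).trace.re =
      ∑ i, ∑ j, a i * (star (Z j i) * (Wᴴ * U) j i).re := by
    have : ((W * Z * Uᴴ)ᴴ * ρ).trace =
        (Zᴴ * (Wᴴ * U) * diagonal (fun i => (a i : ℂ))).trace := by
      rw [hρ.eq, ← Matrix.mul_assoc, Matrix.trace_mul_comm]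
      simp only [conjTranspose_mul, conjTranspose_conjTranspose, ← Matrix.mul_assoc, hU,
        Matrix.one_mul]
    rw [this, trace, Complex.re_sum]
    refine Finset.sum_congr rfl fun i _ => ?_
    rw [diag_apply, mul_diagonal, mul_apply, Complex.re_mul_ofReal, Complex.re_sum,
      Finset.sum_mul]
    refine Finset.sum_congr rfl fun j _ => ?_
    rw [conjTranspose_apply, mul_comm]
  have h₂ : ((W * Z * Uᴴ)ᴴ * σ * (W * Z * Uᴴ)).trace.re =
      ∑ i, ∑ j, b j * Complex.normSq (Z j i) := by
    rw [← trace_conjTranspose_mul_diagonal_mul, hσ.eq]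
    have : (W * Z * Uᴴ)ᴴ * (W * diagonal (fun i => (b i : ℂ)) * Wᴴ) * (W * Z * Uᴴ) =
        U * (Zᴴ * (Wᴴ * W) * diagonal (fun i => (b i : ℂ)) * (Wᴴ * W) * Z * Uᴴ) := by
      simp only [conjTranspose_mul, conjTranspose_conjTranspose, Matrix.mul_assoc]
    rw [this, Matrix.trace_mul_comm, hW, Matrix.mul_assoc _ Uᴴ, hU]
    simp only [Matrix.mul_one]
  have h₃ : ((W * Z * Uᴴ) * ρ * (W * Z * Uᴴ)ᴴ).trace.re =
      ∑ i, ∑ j, a i * Complex.normSq (Z j i) := by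
    rw [← trace_mul_diagonal_mul_conjTranspose, hρ.eq]
    have : (W * Z * Uᴴ) * (U * diagonal (fun i => (a i : ℂ)) * Uᴴ) * (W * Z * Uᴴ)ᴴ =
        W * (Z * (Uᴴ * U) * diagonal (fun i => (a i : ℂ)) * (Uᴴ * U) * Zᴴ * Wᴴ) := by
      simp only [conjTranspose_mul, conjTranspose_conjTranspose, Matrix.mul_assoc]
    rw [this, Matrix.trace_mul_comm, hU, Matrix.mul_assoc _ Wᴴ, hW]
    simp only [Matrix.mul_one]
  rw [resolventForm, h₁, h₂, h₃]
  simp only [Finset.mul_sum, ← Finset.sum_sub_distrib]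
  refine Finset.sum_congr rfl fun i _ => Finset.sum_congr rfl fun j _ => ?_
  ring

lemma two_mul_re_sub_le {a b t : ℝ} (ha : 0 ≤ a) (hb : 0 ≤ b) (ht : 0 < t) (c z : ℂ) :
    2 * (a * (star z * c).re) - (b + t * a) * Complex.normSq z ≤
      Complex.normSq c * (a ^ 2 / (b + t * a)) := by
  rcases ha.eq_or_lt with rfl | ha
  · simp only [zero_mul, mul_zero, add_zero, zero_sub]
    have := mul_nonneg hb (Complex.normSq_nonneg z)
    simp only [ne_eq, OfNat.ofNat_ne_zero, not_false_eq_true, zero_pow, zero_div, mul_zero]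
    linarith
  · have hd : 0 < b + t * a := by positivity
    rw [← mul_div_assoc, le_div_iff₀ hd]
    simp only [Complex.star_def, Complex.mul_re, Complex.conj_re, Complex.conj_im,
      Complex.normSq_apply]
    nlinarith [sq_nonneg ((b + t * a) * z.re - a * c.re),
      sq_nonneg ((b + t * a) * z.im - a * c.im)]

lemma two_mul_re_sub_eq {a b t : ℝ} (ha : 0 ≤ a) (hb : 0 ≤ b) (ht : 0 < t) (c : ℂ) :
    2 * (a * (star (((a / (b + t * a) : ℝ) : ℂ) * c) * c).re)
        - (b + t * a) * Complex.normSq (((a / (b + t * a) : ℝ) : ℂ) * c) =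
      Complex.normSq c * (a ^ 2 / (b + t * a)) := by
  rcases ha.eq_or_lt with rfl | ha
  · simp
  · have hd : b + t * a ≠ 0 := by positivity
    simp only [Complex.star_def, Complex.mul_re, Complex.mul_im, Complex.conj_re,
      Complex.conj_im, Complex.normSq_apply, Complex.ofReal_re, Complex.ofReal_im]
    field_simp
    ring

lemma resolventForm_le {ρ σ U W : Matrix ι ι ℂ} {a b : ι → ℝ}
    (hρ : IsSpectralDecomp ρ U a) (hσ : IsSpectralDecomp σ W b) {t : ℝ} (ht : 0 < t)
    (X : Matrix ι ι ℂ) : resolventForm t ρ σ X ≤ resolventSum U a W b t := by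
  have hX : X = W * (Wᴴ * X * U) * Uᴴ := by
    have : W * (Wᴴ * X * U) * Uᴴ = (W * Wᴴ) * X * (U * Uᴴ) := by
      simp only [Matrix.mul_assoc]
    rw [this, self_mul_conjTranspose_of_mem_unitaryGroup hρ.unitary,
      self_mul_conjTranspose_of_mem_unitaryGroup hσ.unitary, Matrix.one_mul, Matrix.mul_one]
  rw [hX, resolventForm_eq hρ hσ]
  exact Finset.sum_le_sum fun i _ => Finset.sum_le_sum fun j _ =>
    two_mul_re_sub_le (hρ.nonneg i) (hσ.nonneg j) ht _ _

lemma exists_resolventForm_eq {ρ σ U W : Matrix ι ι ℂ} {a b : ι → ℝ}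
    (hρ : IsSpectralDecomp ρ U a) (hσ : IsSpectralDecomp σ W b) {t : ℝ} (ht : 0 < t) :
    ∃ X, resolventForm t ρ σ X = resolventSum U a W b t := by
  refine ⟨W * (Matrix.of fun j i => ((a i / (b j + t * a i) : ℝ) : ℂ) * (Wᴴ * U) j i) * Uᴴ, ?_⟩
  rw [resolventForm_eq hρ hσ]
  exact Finset.sum_congr rfl fun i _ => Finset.sum_congr rfl fun j _ =>
    two_mul_re_sub_eq (hρ.nonneg i) (hσ.nonneg j) ht _

end

lemma hasDerivAt_mul_log_sub {w a b t : ℝ} (ha : 0 ≤ a) (hb : 0 ≤ b) (ht : 0 < t) :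
    HasDerivAt (fun t => w * (a * (Real.log (b + t * a) - Real.log b)))
      (w * (a ^ 2 / (b + t * a))) t := by
  rcases ha.eq_or_lt with rfl | ha
  · simpa using hasDerivAt_const t (0 : ℝ)
  · have hd : b + t * a ≠ 0 := by positivity
    have h : HasDerivAt (fun t => b + t * a) a t := by
      simpa using ((hasDerivAt_id t).mul_const a).const_add b
    rw [sq, mul_div_assoc]
    exact (((h.log hd).sub_const (Real.log b)).const_mul a).const_mul w

lemma continuousOn_mul_log_sub {w a b : ℝ} (ha : 0 ≤ a) (hb : 0 ≤ b)
    (h : b = 0 → w * a = 0) :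
    ContinuousOn (fun t => w * (a * (Real.log (b + t * a) - Real.log b))) (Set.Ici 0) := by
  rcases hb.eq_or_lt with rfl | hb
  · simp only [← mul_assoc, h rfl, zero_mul]
    exact continuousOn_const
  · refine continuousOn_const.mul (continuousOn_const.mul (ContinuousOn.sub ?_ continuousOn_const))
    refine ContinuousOn.log (by fun_prop) fun t ht => ?_
    have := mul_nonneg (Set.mem_Ici.mp ht) ha
    positivity

lemma tendsto_mul_log_sub {w a b : ℝ} (ha : 0 ≤ a) :
    Filter.Tendsto (fun t => w * (a * (Real.log (b + t * a) - Real.log b)) - w * a * Real.log t)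
      Filter.atTop (nhds (w * (a * (Real.log a - Real.log b)))) := by
  rcases ha.eq_or_lt with rfl | ha
  · simp
  · have h₁ : Filter.Tendsto (fun t => Real.log (b / t + a)) Filter.atTop
        (nhds (Real.log a)) := by
      have : Filter.Tendsto (fun t : ℝ => b / t + a) Filter.atTop (nhds (0 + a)) :=
        (Filter.Tendsto.div_atTop tendsto_const_nhds Filter.tendsto_id).add_const a
      rw [zero_add] at this
      exact this.log ha.ne'
    refine ((h₁.sub_const (Real.log b)).const_mul a |>.const_mul w).congr' ?_
    have h₂ : ∀ᶠ t : ℝ in Filter.atTop, b + t * a ≠ 0 := by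
      have : Filter.Tendsto (fun t : ℝ => b + t * a) Filter.atTop Filter.atTop :=
        Filter.tendsto_atTop_add_const_left _ _ (Filter.tendsto_id.atTop_mul_const ha)
      exact this.eventually_ne_atTop 0
    filter_upwards [h₂, Filter.eventually_gt_atTop 0] with t h₂ ht
    have : b / t + a = (b + t * a) / t := by field_simp
    rw [this, Real.log_div h₂ ht.ne']
    ring

section

variable {ι : Type*} [Fintype ι]

/-- The integral of `resolventSum` over `[0, t]`. -/
def resolventPrimitive (U : Matrix ι ι ℂ) (a : ι → ℝ) (W : Matrix ι ι ℂ) (b : ι → ℝ) (t : ℝ) :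
    ℝ :=
  ∑ i, ∑ j, overlap U W i j * (a i * (Real.log (b j + t * a i) - Real.log (b j)))

lemma resolventPrimitive_zero (U : Matrix ι ι ℂ) (a : ι → ℝ) (W : Matrix ι ι ℂ) (b : ι → ℝ) :
    resolventPrimitive U a W b 0 = 0 := by
  simp [resolventPrimitive]

lemma hasDerivAt_resolventPrimitive (U W : Matrix ι ι ℂ) {a b : ι → ℝ} (ha : ∀ i, 0 ≤ a i)
    (hb : ∀ i, 0 ≤ b i) {t : ℝ} (ht : 0 < t) :
    HasDerivAt (resolventPrimitive U a W b) (resolventSum U a W b t) t := by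
  unfold resolventPrimitive resolventSum
  exact HasDerivAt.fun_sum fun i _ => HasDerivAt.fun_sum fun j _ =>
    hasDerivAt_mul_log_sub (ha i) (hb j) ht

lemma continuousOn_resolventPrimitive {U W : Matrix ι ι ℂ} {a b : ι → ℝ} (ha : ∀ i, 0 ≤ a i)
    (hb : ∀ i, 0 ≤ b i) (h : ∀ i j, b j = 0 → overlap U W i j * a i = 0) :
    ContinuousOn (resolventPrimitive U a W b) (Set.Ici 0) := by
  unfold resolventPrimitive
  exact continuousOn_finsetSum _ fun i _ => continuousOn_finsetSum _ fun j _ =>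
    continuousOn_mul_log_sub (ha i) (hb j) (h i j)

end

section

variable {ι : Type*} [Fintype ι] [DecidableEq ι]

lemma conjTranspose_mul_mul_apply_self_re {ρ U W : Matrix ι ι ℂ} {a : ι → ℝ}
    (hρ : IsSpectralDecomp ρ U a) (j : ι) :
    ((Wᴴ * ρ * W) j j).re = ∑ i, overlap U W i j * a i := by
  have : Wᴴ * ρ * W = (Wᴴ * U) * diagonal (fun i => (a i : ℂ)) * (Wᴴ * U)ᴴ := by
    rw [hρ.eq]
    simp only [conjTranspose_mul, conjTranspose_conjTranspose, Matrix.mul_assoc]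
  rw [this, mul_apply, Complex.re_sum]
  refine Finset.sum_congr rfl fun i _ => ?_
  rw [mul_diagonal, conjTranspose_apply, overlap]
  simp [Complex.normSq_apply]
  ring

lemma sum_overlap_right {U W : Matrix ι ι ℂ} (hU : U ∈ unitaryGroup ι ℂ)
    (hW : W ∈ unitaryGroup ι ℂ) (i : ι) : ∑ j, overlap U W i j = 1 := by
  have h : (Wᴴ * U)ᴴ * (Wᴴ * U) = 1 := by
    have : (Wᴴ * U)ᴴ * (Wᴴ * U) = Uᴴ * (W * Wᴴ) * U := by
      simp only [conjTranspose_mul, conjTranspose_conjTranspose, Matrix.mul_assoc]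
    rw [this, self_mul_conjTranspose_of_mem_unitaryGroup hW, Matrix.mul_one,
      conjTranspose_mul_self_of_mem_unitaryGroup hU]
  have h' := congrArg (fun M : Matrix ι ι ℂ => (M i i).re) h
  simp only [one_apply_eq, Complex.one_re] at h'
  rw [mul_apply, Complex.re_sum] at h'
  rw [← h']
  refine Finset.sum_congr rfl fun j _ => ?_
  rw [conjTranspose_apply, overlap, Complex.normSq_apply, Complex.mul_re]
  simp

lemma sum_overlap_mul_eq_trace {ρ U W : Matrix ι ι ℂ} {a : ι → ℝ}
    (hρ : IsSpectralDecomp ρ U a) (hW : W ∈ unitaryGroup ι ℂ) :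
    ∑ i, ∑ j, overlap U W i j * a i = ρ.trace.re := by
  have h : ρ.trace = ∑ i, (a i : ℂ) := by
    rw [hρ.eq, Matrix.mul_assoc, Matrix.trace_mul_comm, Matrix.mul_assoc,
      conjTranspose_mul_self_of_mem_unitaryGroup hρ.unitary, Matrix.mul_one, trace_diagonal]
  rw [h, ← Complex.ofReal_sum, Complex.ofReal_re]
  refine Finset.sum_congr rfl fun i _ => ?_
  rw [← Finset.sum_mul, sum_overlap_right hρ.unitary hW, one_mul]

lemma overlap_mul_eq_zero {ρ σ U W : Matrix ι ι ℂ} {a b : ι → ℝ}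
    (hρ : IsSpectralDecomp ρ U a) (hσ : IsSpectralDecomp σ W b) {c : ℝ} (hc : 0 < c)
    (h : (σ - c • ρ).PosSemidef) (i j : ι) (hb : b j = 0) : overlap U W i j * a i = 0 := by
  have h₁ : 0 ≤ ((Wᴴ * (σ - c • ρ) * W) j j).re :=
    (Complex.le_def.mp ((h.conjTranspose_mul_mul_same W).diag_nonneg (i := j))).1
  have h₂ : ((Wᴴ * σ * W) j j).re = b j := by
    have : Wᴴ * σ * W = (Wᴴ * W) * diagonal (fun i => (b i : ℂ)) * (Wᴴ * W) := by
      rw [hσ.eq]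
      simp only [Matrix.mul_assoc]
    rw [this, conjTranspose_mul_self_of_mem_unitaryGroup hσ.unitary]
    simp
  rw [Matrix.mul_sub, Matrix.sub_mul, Matrix.mul_smul, Matrix.smul_mul, Matrix.sub_apply,
    Matrix.smul_apply, Complex.sub_re, Complex.smul_re, h₂, hb,
    conjTranspose_mul_mul_apply_self_re hρ] at h₁
  have hnn : ∀ i ∈ Finset.univ, 0 ≤ overlap U W i j * a i := fun i _ =>
    mul_nonneg (overlap_nonneg U W i j) (hρ.nonneg i)
  have h0 : ∑ i, overlap U W i j * a i = 0 := by
    refine le_antisymm ?_ (Finset.sum_nonneg hnn)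
    by_contra! hpos
    have := mul_pos hc hpos
    simp only [smul_eq_mul] at h₁
    linarith
  exact (Finset.sum_eq_zero_iff_of_nonneg hnn).mp h0 i (Finset.mem_univ i)

lemma tendsto_resolventPrimitive {ρ U W : Matrix ι ι ℂ} {a : ι → ℝ} (b : ι → ℝ)
    (hρ : IsSpectralDecomp ρ U a) (hW : W ∈ unitaryGroup ι ℂ) :
    Filter.Tendsto (fun t => resolventPrimitive U a W b t - ρ.trace.re * Real.log t)
      Filter.atTop (nhds (spectralRelEnt U a W b)) := by
  have : ∀ t, resolventPrimitive U a W b t - ρ.trace.re * Real.log t = ∑ i, ∑ j,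
      (overlap U W i j * (a i * (Real.log (b j + t * a i) - Real.log (b j)))
        - overlap U W i j * a i * Real.log t) := fun t => by
    rw [← sum_overlap_mul_eq_trace hρ hW]
    simp only [resolventPrimitive, Finset.sum_mul, ← Finset.sum_sub_distrib]
  simp only [this]
  exact tendsto_finsetSum _ fun i _ => tendsto_finsetSum _ fun j _ =>
    tendsto_mul_log_sub (hρ.nonneg i)

end

section

variable {n m : ℕ} {Ω K : Type*} [Fintype K]

lemma trace_instAct (V : Ω → K → Matrix (Fin m) (Fin n) ℂ) (ω : Ω)
    (ρ : Matrix (Fin n) (Fin n) ℂ) : (instAct V ω ρ).trace.re = probOut V ρ ω := by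
  simp only [instAct, probOut, povm, trace_sum, Matrix.sum_mul]
  congr 1
  refine Finset.sum_congr rfl fun k _ => ?_
  rw [Matrix.mul_assoc, Matrix.trace_mul_comm, Matrix.mul_assoc, Matrix.trace_mul_comm]

lemma instAct_posSemidef (V : Ω → K → Matrix (Fin m) (Fin n) ℂ) (ω : Ω)
    {ρ : Matrix (Fin n) (Fin n) ℂ} (hρ : ρ.PosSemidef) : (instAct V ω ρ).PosSemidef :=
  posSemidef_sum _ fun _ _ => hρ.mul_mul_conjTranspose_same _

lemma instAct_sub_smul (V : Ω → K → Matrix (Fin m) (Fin n) ℂ) (ω : Ω)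
    (ρ σ : Matrix (Fin n) (Fin n) ℂ) (c : ℝ) :
    instAct V ω (σ - c • ρ) = instAct V ω σ - c • instAct V ω ρ := by
  simp only [instAct, Matrix.mul_sub, Matrix.sub_mul, Finset.sum_sub_distrib, Matrix.mul_smul,
    Matrix.smul_mul, Finset.smul_sum]

variable [Fintype Ω] {V : Ω → K → Matrix (Fin m) (Fin n) ℂ}

lemma trace_mul_dual_eq (V : Ω → K → Matrix (Fin m) (Fin n) ℂ) (ρ : Matrix (Fin n) (Fin n) ℂ)
    (Y : Ω → Matrix (Fin m) (Fin m) ℂ) :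
    ((∑ ω, ∑ k, (V ω k)ᴴ * Y ω * V ω k) * ρ).trace = ∑ ω, (Y ω * instAct V ω ρ).trace := by
  simp only [Matrix.sum_mul, trace_sum, instAct, Matrix.mul_sum]
  refine Finset.sum_congr rfl fun ω _ => Finset.sum_congr rfl fun k _ => ?_
  rw [Matrix.mul_assoc, Matrix.mul_assoc, Matrix.trace_mul_comm]
  simp only [Matrix.mul_assoc]

lemma conjTranspose_dual (V : Ω → K → Matrix (Fin m) (Fin n) ℂ)
    (Y : Ω → Matrix (Fin m) (Fin m) ℂ) :
    (∑ ω, ∑ k, (V ω k)ᴴ * Y ω * V ω k)ᴴ = ∑ ω, ∑ k, (V ω k)ᴴ * (Y ω)ᴴ * V ω k := by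
  simp only [conjTranspose_sum, conjTranspose_mul, conjTranspose_conjTranspose, Matrix.mul_assoc]

/-- The Kadison–Schwarz inequality, in the form of an inequality between traces. -/
lemma trace_conjTranspose_dual_mul_le (hV : ∑ ω, ∑ k, (V ω k)ᴴ * V ω k = 1)
    {σ : Matrix (Fin n) (Fin n) ℂ} (hσ : σ.PosSemidef) (Y : Ω → Matrix (Fin m) (Fin m) ℂ)
    {X : Matrix (Fin n) (Fin n) ℂ} (hX : X = ∑ ω, ∑ k, (V ω k)ᴴ * Y ω * V ω k) :
    (Xᴴ * σ * X).trace.re ≤ ∑ ω, ((Y ω)ᴴ * instAct V ω σ * Y ω).trace.re := by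
  have hX' : Xᴴ = ∑ ω, ∑ k, (V ω k)ᴴ * (Y ω)ᴴ * V ω k := by rw [hX, conjTranspose_dual]
  have hpos : ∀ ω k, 0 ≤ ((((Y ω)ᴴ * V ω k - V ω k * Xᴴ) * σ *
      ((Y ω)ᴴ * V ω k - V ω k * Xᴴ)ᴴ).trace).re := fun ω k =>
    (Complex.le_def.mp (hσ.mul_mul_conjTranspose_same _).trace_nonneg).1
  have hexp : ∀ ω k, (((Y ω)ᴴ * V ω k - V ω k * Xᴴ) * σ *
      ((Y ω)ᴴ * V ω k - V ω k * Xᴴ)ᴴ).trace =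
      ((Y ω)ᴴ * (V ω k * σ * (V ω k)ᴴ) * Y ω).trace
        - ((V ω k)ᴴ * (Y ω)ᴴ * V ω k * (σ * X)).trace
        - ((V ω k)ᴴ * Y ω * V ω k * (Xᴴ * σ)).trace
        + ((V ω k)ᴴ * V ω k * (Xᴴ * σ * X)).trace := fun ω k => by
    have h₁ : ((V ω k)ᴴ * (Y ω)ᴴ * V ω k * (σ * X)).trace =
        ((Y ω)ᴴ * V ω k * σ * X * (V ω k)ᴴ).trace := by
      rw [Matrix.trace_mul_comm _ (V ω k)ᴴ]
      simp only [Matrix.mul_assoc]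
    have h₂ : ((V ω k)ᴴ * Y ω * V ω k * (Xᴴ * σ)).trace =
        (V ω k * Xᴴ * σ * (V ω k)ᴴ * Y ω).trace := by
      rw [Matrix.mul_assoc _ (V ω k), Matrix.trace_mul_comm]
      simp only [Matrix.mul_assoc]
    have h₃ : ((V ω k)ᴴ * V ω k * (Xᴴ * σ * X)).trace =
        (V ω k * Xᴴ * σ * X * (V ω k)ᴴ).trace := by
      rw [Matrix.trace_mul_comm _ (V ω k)ᴴ]
      simp only [Matrix.mul_assoc]
    rw [h₁, h₂, h₃, ← trace_sub, ← trace_sub, ← trace_add]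
    congr 1
    simp only [conjTranspose_sub, conjTranspose_mul, conjTranspose_conjTranspose,
      Matrix.sub_mul, Matrix.mul_sub, Matrix.mul_assoc]
    abel
  have hsum : ∑ ω, ∑ k, (((Y ω)ᴴ * V ω k - V ω k * Xᴴ) * σ *
      ((Y ω)ᴴ * V ω k - V ω k * Xᴴ)ᴴ).trace =
      ∑ ω, ((Y ω)ᴴ * instAct V ω σ * Y ω).trace - (Xᴴ * σ * X).trace := by
    simp only [hexp, Finset.sum_sub_distrib, Finset.sum_add_distrib]
    simp only [← trace_sum, ← Matrix.sum_mul, ← hX, ← hX', hV, instAct, Matrix.mul_sum]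
    rw [Matrix.one_mul, ← Matrix.mul_assoc Xᴴ σ X, Matrix.trace_mul_comm X]
    ring
  have h := congrArg Complex.re hsum
  rw [Complex.sub_re, Complex.re_sum, Complex.re_sum] at h
  simp only [Complex.re_sum] at h
  have h0 := Finset.sum_nonneg fun ω (_ : ω ∈ Finset.univ) =>
    Finset.sum_nonneg fun k (_ : k ∈ Finset.univ) => hpos ω k
  linarith

lemma sum_resolventForm_le (hV : ∑ ω, ∑ k, (V ω k)ᴴ * V ω k = 1)
    {ρ σ : Matrix (Fin n) (Fin n) ℂ} (hρ : ρ.PosSemidef) (hσ : σ.PosSemidef) {t : ℝ}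
    (ht : 0 ≤ t) (Y : Ω → Matrix (Fin m) (Fin m) ℂ) :
    ∑ ω, resolventForm t (instAct V ω ρ) (instAct V ω σ) (Y ω) ≤
      resolventForm t ρ σ (∑ ω, ∑ k, (V ω k)ᴴ * Y ω * V ω k) := by
  have h₁ := trace_conjTranspose_dual_mul_le hV hσ Y rfl
  have h₂ := trace_conjTranspose_dual_mul_le hV hρ (fun ω => (Y ω)ᴴ) rfl
  have h₃ := congrArg Complex.re (trace_mul_dual_eq V ρ fun ω => (Y ω)ᴴ)
  rw [← conjTranspose_dual] at h₂ h₃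
  simp only [conjTranspose_conjTranspose] at h₂
  rw [Complex.re_sum] at h₃
  simp only [resolventForm, Finset.sum_sub_distrib, ← Finset.mul_sum]
  rw [h₃]
  linarith [mul_le_mul_of_nonneg_left h₂ ht]

lemma sum_trace_instAct (hV : ∑ ω, ∑ k, (V ω k)ᴴ * V ω k = 1) (ρ : Matrix (Fin n) (Fin n) ℂ) :
    ∑ ω, (instAct V ω ρ).trace.re = ρ.trace.re := by
  have h := congrArg Complex.re (trace_mul_dual_eq V ρ fun _ => 1)
  simp only [Matrix.mul_one, hV, Matrix.one_mul, Complex.re_sum] at h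
  exact h.symm

/-- Monotonicity of the relative entropy under an instrument, in terms of spectral data. -/
theorem sum_spectralRelEnt_instAct_le (hV : ∑ ω, ∑ k, (V ω k)ᴴ * V ω k = 1)
    {ρ σ U W : Matrix (Fin n) (Fin n) ℂ} {a b : Fin n → ℝ} (hρ : ρ.PosSemidef)
    (hσ : σ.PosSemidef) {c : ℝ} (hc : 0 < c) (hle : (σ - c • ρ).PosSemidef)
    (hρU : IsSpectralDecomp ρ U a) (hσW : IsSpectralDecomp σ W b)
    {U' W' : Ω → Matrix (Fin m) (Fin m) ℂ} {a' b' : Ω → Fin m → ℝ}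
    (hρU' : ∀ ω, IsSpectralDecomp (instAct V ω ρ) (U' ω) (a' ω))
    (hσW' : ∀ ω, IsSpectralDecomp (instAct V ω σ) (W' ω) (b' ω)) :
    ∑ ω, spectralRelEnt (U' ω) (a' ω) (W' ω) (b' ω) ≤ spectralRelEnt U a W b := by
  have hform : ∀ t, 0 < t →
      ∑ ω, resolventSum (U' ω) (a' ω) (W' ω) (b' ω) t ≤ resolventSum U a W b t := by
    intro t ht
    choose Y hY using fun ω => exists_resolventForm_eq (hρU' ω) (hσW' ω) ht
    simp only [← hY]
    exact (sum_resolventForm_le hV hρ hσ ht.le Y).trans (resolventForm_le hρU hσW ht _)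
  have hmono : MonotoneOn (fun t => resolventPrimitive U a W b t -
      ∑ ω, resolventPrimitive (U' ω) (a' ω) (W' ω) (b' ω) t) (Set.Ici 0) := by
    refine monotoneOn_of_hasDerivWithinAt_nonneg (convex_Ici 0)
      (f' := fun t => resolventSum U a W b t - ∑ ω, resolventSum (U' ω) (a' ω) (W' ω) (b' ω) t)
      ?_ ?_ ?_
    · refine (continuousOn_resolventPrimitive hρU.nonneg hσW.nonneg
        (overlap_mul_eq_zero hρU hσW hc hle)).sub (continuousOn_finsetSum _ fun ω _ => ?_)
      refine continuousOn_resolventPrimitive (hρU' ω).nonneg (hσW' ω).nonneg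
        (overlap_mul_eq_zero (hρU' ω) (hσW' ω) hc ?_)
      rw [← instAct_sub_smul]
      exact instAct_posSemidef V ω hle
    · intro t ht
      rw [interior_Ici] at ht
      exact ((hasDerivAt_resolventPrimitive U W hρU.nonneg hσW.nonneg ht).sub
        (HasDerivAt.fun_sum fun ω _ => hasDerivAt_resolventPrimitive (U' ω) (W' ω)
          (hρU' ω).nonneg (hσW' ω).nonneg ht)).hasDerivWithinAt
    · intro t ht
      rw [interior_Ici] at ht
      exact sub_nonneg.mpr (hform t ht)
  refine le_of_tendsto_of_tendsto (tendsto_finsetSum _ fun ω _ =>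
    tendsto_resolventPrimitive (b' ω) (hρU' ω) (hσW' ω).unitary)
    (tendsto_resolventPrimitive b hρU hσW.unitary) ?_
  filter_upwards [Filter.eventually_ge_atTop 0] with t ht
  have := hmono Set.self_mem_Ici ht ht
  simp only [resolventPrimitive_zero, Finset.sum_const_zero, sub_zero] at this
  rw [Finset.sum_sub_distrib, ← Finset.sum_mul, sum_trace_instAct hV]
  linarith

end

section

variable {ι : Type*} [Fintype ι] [DecidableEq ι]

lemma isSpectralDecomp_eigenvectorUnitary {A : Matrix ι ι ℂ} (hA : A.PosSemidef) :
    IsSpectralDecomp A hA.1.eigenvectorUnitary hA.1.eigenvalues where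
  unitary := hA.1.eigenvectorUnitary.2
  nonneg := hA.eigenvalues_nonneg
  eq := by
    conv_lhs => rw [hA.1.spectral_theorem]
    rfl

lemma IsSpectralDecomp.smul {A U : Matrix ι ι ℂ} {a : ι → ℝ} (h : IsSpectralDecomp A U a)
    {c : ℝ} (hc : 0 ≤ c) : IsSpectralDecomp (c • A) U (fun i => c * a i) where
  unitary := h.unitary
  nonneg i := mul_nonneg hc (h.nonneg i)
  eq := by
    have : diagonal (fun i => ((c * a i : ℝ) : ℂ)) = c • diagonal (fun i => (a i : ℂ)) := by
      ext i j
      by_cases hij : i = j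
      · subst hij
        simp
      · simp [hij]
    rw [this, h.eq, Matrix.mul_smul, Matrix.smul_mul]

lemma relEnt_eq_spectralRelEnt {σ τ : Matrix ι ι ℂ} (hσ : σ.PosSemidef) (hτ : τ.PosSemidef) :
    relEnt σ τ = spectralRelEnt hσ.1.eigenvectorUnitary hσ.1.eigenvalues
      hτ.1.eigenvectorUnitary hτ.1.eigenvalues := by
  have hU := isSpectralDecomp_eigenvectorUnitary hσ
  have hW := isSpectralDecomp_eigenvectorUnitary hτ
  rw [relEnt, dif_pos ⟨hσ.1, hτ.1⟩, spectralRelEnt]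
  simp only [mul_sub, Finset.sum_sub_distrib]
  congr 1
  · refine Finset.sum_congr rfl fun i _ => ?_
    rw [← Finset.sum_mul, sum_overlap_right hU.unitary hW.unitary, one_mul]
  · rw [Finset.sum_comm]
    refine Finset.sum_congr rfl fun j _ => ?_
    have h : star (fun i => hτ.1.eigenvectorBasis j i) ⬝ᵥ
        σ.mulVec (fun i => hτ.1.eigenvectorBasis j i) =
        ((hτ.1.eigenvectorUnitary : Matrix ι ι ℂ)ᴴ * σ * hτ.1.eigenvectorUnitary) j j := by
      rw [Matrix.mul_assoc, mul_apply]
      rfl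
    rw [h, conjTranspose_mul_mul_apply_self_re hU, Finset.mul_sum]
    split_ifs with hj
    · exact Finset.sum_congr rfl fun i _ => by ring
    · have : hτ.1.eigenvalues j = 0 := le_antisymm (not_lt.mp hj) (hτ.eigenvalues_nonneg j)
      simp [this]

lemma spectralRelEnt_smul {ρ σ U W : Matrix ι ι ℂ} {a b : ι → ℝ}
    (hρ : IsSpectralDecomp ρ U a) (hσ : IsSpectralDecomp σ W b)
    (h : ∀ i j, b j = 0 → overlap U W i j * a i = 0) {s r : ℝ} (hs : s ≠ 0) (hr : r ≠ 0) :
    spectralRelEnt U (fun i => s * a i) W (fun j => r * b j) =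
      s * Real.log (s / r) * ρ.trace.re + s * spectralRelEnt U a W b := by
  rw [← sum_overlap_mul_eq_trace hρ hσ.unitary]
  simp only [spectralRelEnt, Finset.mul_sum, ← Finset.sum_add_distrib]
  refine Finset.sum_congr rfl fun i _ => Finset.sum_congr rfl fun j _ => ?_
  by_cases hw : overlap U W i j * a i = 0
  · linear_combination (s * (Real.log (s * a i) - Real.log (r * b j))
      - s * Real.log (s / r) - s * (Real.log (a i) - Real.log (b j))) * hw
  · have ha : a i ≠ 0 := right_ne_zero_of_mul hw
    have hb : b j ≠ 0 := fun hb => hw (h i j hb)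
    rw [Real.log_mul hs ha, Real.log_mul hr hb, Real.log_div hs hr]
    ring

end

section

variable {n m : ℕ} {Ω K : Type*} [Fintype K]

lemma post_posSemidef (V : Ω → K → Matrix (Fin m) (Fin n) ℂ) (ω : Ω)
    {ρ : Matrix (Fin n) (Fin n) ℂ} (hρ : ρ.PosSemidef) : (post V ω ρ).PosSemidef := by
  have h := instAct_posSemidef V ω hρ
  exact h.smul (inv_nonneg.mpr (Complex.le_def.mp h.trace_nonneg).1)

lemma probOut_nonneg (V : Ω → K → Matrix (Fin m) (Fin n) ℂ) (ω : Ω)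
    {ρ : Matrix (Fin n) (Fin n) ℂ} (hρ : ρ.PosSemidef) : 0 ≤ probOut V ρ ω := by
  rw [← trace_instAct]
  exact (Complex.le_def.mp (instAct_posSemidef V ω hρ).trace_nonneg).1

lemma instAct_eq_smul_post (V : Ω → K → Matrix (Fin m) (Fin n) ℂ) (ω : Ω)
    {ρ : Matrix (Fin n) (Fin n) ℂ} (hρ : ρ.PosSemidef) :
    instAct V ω ρ = probOut V ρ ω • post V ω ρ := by
  rw [post, trace_instAct, smul_smul]
  by_cases h : probOut V ρ ω = 0
  · have hI := instAct_posSemidef V ω hρ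
    have h0 : instAct V ω ρ = 0 := by
      rw [← hI.trace_eq_zero_iff]
      refine Complex.ext ((trace_instAct V ω ρ).trans h) ?_
      exact (Complex.le_def.mp hI.trace_nonneg).2.symm
    simp [h0]
  · rw [mul_inv_cancel₀ h, one_smul]

lemma trace_post (V : Ω → K → Matrix (Fin m) (Fin n) ℂ) (ω : Ω) {ρ : Matrix (Fin n) (Fin n) ℂ}
    (h : probOut V ρ ω ≠ 0) : (post V ω ρ).trace.re = 1 := by
  rw [post, trace_smul, Complex.smul_re, trace_instAct, smul_eq_mul, inv_mul_cancel₀ h]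

lemma mul_probOut_le (V : Ω → K → Matrix (Fin m) (Fin n) ℂ) (ω : Ω)
    {ρ σ : Matrix (Fin n) (Fin n) ℂ} {c : ℝ} (hle : (σ - c • ρ).PosSemidef) :
    c * probOut V ρ ω ≤ probOut V σ ω := by
  have h := probOut_nonneg V ω hle
  rw [← trace_instAct, instAct_sub_smul, trace_sub, trace_smul, Complex.sub_re, Complex.smul_re,
    trace_instAct, trace_instAct, smul_eq_mul] at h
  linarith

/-- Monotonicity of the relative entropy under an instrument, with the output relative entropy
split into its classical part and the average over the outcomes of the posterior part. -/
theorem sum_relEnt_post_le_relEnt [Fintype Ω] {V : Ω → K → Matrix (Fin m) (Fin n) ℂ}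
    (hV : ∑ ω, ∑ k, (V ω k)ᴴ * V ω k = 1) {ρ σ : Matrix (Fin n) (Fin n) ℂ}
    (hρ : ρ.PosSemidef) (hσ : σ.PosSemidef) {c : ℝ} (hc : 0 < c)
    (hle : (σ - c • ρ).PosSemidef) :
    ∑ ω, (if 0 < probOut V ρ ω then
      probOut V ρ ω * Real.log (probOut V ρ ω / probOut V σ ω)
        + probOut V ρ ω * relEnt (post V ω ρ) (post V ω σ) else 0) ≤ relEnt ρ σ := by
  have hρ' := fun ω => post_posSemidef V ω hρ
  have hσ' := fun ω => post_posSemidef V ω hσ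
  have hU := fun ω => isSpectralDecomp_eigenvectorUnitary (hρ' ω)
  have hW := fun ω => isSpectralDecomp_eigenvectorUnitary (hσ' ω)
  have hU' : ∀ ω, IsSpectralDecomp (instAct V ω ρ) _ _ := fun ω =>
    (instAct_eq_smul_post V ω hρ).symm ▸ (hU ω).smul (probOut_nonneg V ω hρ)
  have hW' : ∀ ω, IsSpectralDecomp (instAct V ω σ) _ _ := fun ω =>
    (instAct_eq_smul_post V ω hσ).symm ▸ (hW ω).smul (probOut_nonneg V ω hσ)
  refine le_trans (Finset.sum_le_sum fun ω _ => ?_) ((sum_spectralRelEnt_instAct_le hV hρ hσ hc hle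
    (isSpectralDecomp_eigenvectorUnitary hρ) (isSpectralDecomp_eigenvectorUnitary hσ)
    hU' hW').trans_eq (relEnt_eq_spectralRelEnt hρ hσ).symm)
  split_ifs with hs
  · have hr : 0 < probOut V σ ω := (mul_pos hc hs).trans_le (mul_probOut_le V ω hle)
    have hle' : (post V ω σ - (c * probOut V ρ ω / probOut V σ ω) • post V ω ρ).PosSemidef := by
      have h := (instAct_posSemidef V ω hle).smul (inv_nonneg.mpr hr.le)
      rw [instAct_sub_smul, instAct_eq_smul_post V ω hρ, instAct_eq_smul_post V ω hσ, smul_sub,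
        smul_smul, smul_smul, smul_smul, inv_mul_cancel₀ hr.ne', one_smul] at h
      convert h using 3
      ring
    rw [spectralRelEnt_smul (hU ω) (hW ω)
      (overlap_mul_eq_zero (hU ω) (hW ω) (by positivity) hle') hs.ne' hr.ne',
      trace_post V ω hs.ne', mul_one, relEnt_eq_spectralRelEnt (hρ' ω) (hσ' ω)]
  · have h0 : probOut V ρ ω = 0 := le_antisymm (not_lt.mp hs) (probOut_nonneg V ω hρ)
    simp [spectralRelEnt, h0]

lemma sum_smul_sub_smul_posSemidef {A : Type*} [Fintype A] {p : A → ℝ} (hp : ∀ α, 0 ≤ p α)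
    {ρ : A → Matrix (Fin n) (Fin n) ℂ} (hρ : ∀ α, (ρ α).PosSemidef) (α : A) :
    ((∑ β, p β • ρ β) - p α • ρ α).PosSemidef := by
  classical
  rw [← Finset.sum_erase_eq_sub (Finset.mem_univ α)]
  exact posSemidef_sum _ fun β _ => (hρ β).smul (hp β)

end

theorem generalized_SWW_inequality {A Ω K : Type*} [Fintype A] [Fintype Ω] [Fintype K]
    [Nonempty A] [Nonempty Ω] [Nonempty K] {n m : ℕ} (hn : 1 ≤ n) (hm : 1 ≤ m)
    (p : A → ℝ) (hp0 : ∀ α, 0 ≤ p α) (hp1 : ∑ α, p α = 1)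
    (ρ : A → Matrix (Fin n) (Fin n) ℂ) (hρ : ∀ α, IsDensityMatrix (ρ α))
    (V : Ω → K → Matrix (Fin m) (Fin n) ℂ)
    (hV : ∑ ω, ∑ k, (V ω k)ᴴ * V ω k = 1)
    (η : Matrix (Fin n) (Fin n) ℂ) (hη : η = ∑ α, p α • ρ α)
    (Pf : Ω → ℝ) (hPf : ∀ ω, Pf ω = probOut V η ω) :
    holevoChi p ρ ≥
      Ic p ρ V +
        ∑ ω, (if 0 < Pf ω then
        Pf ω * ∑ α, (if 0 < p α * probOut V (ρ α) ω then
          (p α * probOut V (ρ α) ω / Pf ω) *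
            relEnt (post V ω (ρ α)) (post V ω η)
        else 0)
      else 0) := by
  have hρ0 := fun α => (hρ α).1
  have hη0 : η.PosSemidef := hη ▸ posSemidef_sum _ fun α _ => (hρ0 α).smul (hp0 α)
  have hle : ∀ α, (η - p α • ρ α).PosSemidef := fun α =>
    hη ▸ sum_smul_sub_smul_posSemidef hp0 hρ0 α
  have hpost : ∀ ω, (if 0 < Pf ω then
        Pf ω * ∑ α, (if 0 < p α * probOut V (ρ α) ω then
          (p α * probOut V (ρ α) ω / Pf ω) * relEnt (post V ω (ρ α)) (post V ω η)
        else 0)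
      else 0) = ∑ α, if 0 < p α * probOut V (ρ α) ω then
        p α * probOut V (ρ α) ω * relEnt (post V ω (ρ α)) (post V ω η) else 0 := by
    intro ω
    split_ifs with h
    · rw [Finset.mul_sum]
      refine Finset.sum_congr rfl fun α _ => ?_
      split_ifs
      · field_simp
      · rw [mul_zero]
    · refine (Finset.sum_eq_zero fun α _ => if_neg fun hα => h ?_).symm
      rw [hPf]
      exact hα.trans_le (mul_probOut_le V ω (hle α))
  simp only [hpost]
  rw [Finset.sum_comm, holevoChi, Ic, ← Finset.sum_add_distrib, ← hη]
  refine Finset.sum_le_sum fun α _ => ?_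
  rw [← Finset.sum_add_distrib]
  split_ifs with hα
  · refine le_trans (le_of_eq ?_) (mul_le_mul_of_nonneg_left
      (sum_relEnt_post_le_relEnt hV (hρ0 α) hη0 hα (hle α)) hα.le)
    rw [Finset.mul_sum]
    refine Finset.sum_congr rfl fun ω _ => ?_
    simp only [mul_pos_iff_of_pos_left hα, mul_div_mul_left _ _ hα.ne']
    split_ifs <;> ring
  · have h0 : p α = 0 := le_antisymm (not_lt.mp hα) (hp0 α)
    simp [h0]

end
end

section
/- Holevo's bound (discrete, finite-dimensional form): I_c ≤ χ{p, ρ}, i.e. the classical mutual information extracted by any POVM from the initial ensemble is at most the Holevo χ-quantity of the ensemble. -/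
open Matrix BigOperators
open scoped Kronecker ComplexOrder

noncomputable section

open Filter Topology in
/-- If `∑ P² / (Q + sP) ≤ ∑ p² / (q + sp)` for all `s > 0`, then the Kullback-Leibler divergence
of `P` from `Q` is at most that of `p` from `q`. -/
theorem sum_mul_log_sub_log_le_of_sum_sq_div_le {I J : Type*} [Fintype I] [Fintype J]
    {p q : I → ℝ} {P Q : J → ℝ}
    (hp : ∀ i, 0 ≤ p i) (hq : ∀ i, 0 ≤ q i) (hpq : ∀ i, 0 < p i → 0 < q i)
    (hP : ∀ j, 0 ≤ P j) (hQ : ∀ j, 0 ≤ Q j) (hPQ : ∀ j, 0 < P j → 0 < Q j)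
    (hsum : ∑ j, P j = ∑ i, p i)
    (h : ∀ s : ℝ, 0 < s → ∑ j, P j ^ 2 / (Q j + s * P j) ≤ ∑ i, p i ^ 2 / (q i + s * p i)) :
    ∑ j, P j * (Real.log (P j) - Real.log (Q j)) ≤
      ∑ i, p i * (Real.log (p i) - Real.log (q i)) := by
  have hderiv : ∀ x y : ℝ, 0 ≤ x → (0 < x → 0 < y) → ∀ s : ℝ, 0 ≤ s →
      HasDerivAt (fun s => x * Real.log (y + s * x)) (x ^ 2 / (y + s * x)) s := by
    intro x y hx hxy s hs
    rcases hx.eq_or_lt with rfl | hx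
    · simpa using hasDerivAt_const s (0 : ℝ)
    · have hpos : y + s * x ≠ 0 := by have := hxy hx; positivity
      have h1 : HasDerivAt (fun s => y + s * x) x s := by
        simpa using ((hasDerivAt_id s).mul_const x).const_add y
      have h2 := (h1.log hpos).const_mul x
      rwa [← mul_div_assoc, ← sq] at h2
  have hlim : ∀ x y : ℝ, 0 ≤ x → Tendsto (fun s : ℝ => x * Real.log (y / s + x)) atTop
      (𝓝 (x * Real.log x)) := by
    intro x y hx
    rcases hx.eq_or_lt with rfl | hx
    · simp
    · have h1 : Tendsto (fun s : ℝ => y / s + x) atTop (𝓝 x) := by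
        simpa using (tendsto_const_nhds.div_atTop tendsto_id : Tendsto (fun s : ℝ => y / s)
          atTop (𝓝 0)).add_const x
      exact (h1.log hx.ne').const_mul x
  have hsplit : ∀ x y : ℝ, 0 ≤ x → 0 ≤ y → ∀ s : ℝ, 0 < s →
      x * Real.log (y + s * x) = x * Real.log s + x * Real.log (y / s + x) := by
    intro x y hx hy s hs
    rcases hx.eq_or_lt with rfl | hx
    · simp
    · rw [← mul_add, ← Real.log_mul hs.ne' (by positivity)]
      congr 2
      field_simp
  set f : ℝ → ℝ := fun s =>
    ∑ i, p i * Real.log (q i + s * p i) - ∑ j, P j * Real.log (Q j + s * P j) with hf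
  have hfd : ∀ s : ℝ, 0 ≤ s → HasDerivAt f
      (∑ i, p i ^ 2 / (q i + s * p i) - ∑ j, P j ^ 2 / (Q j + s * P j)) s := fun s hs =>
    (HasDerivAt.fun_sum fun i _ => hderiv _ _ (hp i) (hpq i) s hs).sub
      (HasDerivAt.fun_sum fun j _ => hderiv _ _ (hP j) (hPQ j) s hs)
  have hmono : MonotoneOn f (Set.Ici 0) := by
    refine monotoneOn_of_deriv_nonneg (convex_Ici 0)
      (fun s hs => (hfd s hs).continuousAt.continuousWithinAt) ?_ ?_
    · intro s hs
      rw [interior_Ici] at hs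
      exact (hfd s (le_of_lt hs)).differentiableAt.differentiableWithinAt
    · intro s hs
      rw [interior_Ici] at hs
      rw [(hfd s (le_of_lt hs)).deriv]
      exact sub_nonneg.2 (h s hs)
  have hflim : Tendsto f atTop
      (𝓝 (∑ i, p i * Real.log (p i) - ∑ j, P j * Real.log (P j))) := by
    have h1 := (tendsto_finsetSum Finset.univ fun i _ => hlim (p i) (q i) (hp i)).sub
      (tendsto_finsetSum Finset.univ fun j _ => hlim (P j) (Q j) (hP j))
    refine h1.congr' ?_
    filter_upwards [eventually_gt_atTop 0] with s hs
    simp only [hf, hsplit _ _ (hp _) (hq _) s hs, hsplit _ _ (hP _) (hQ _) s hs,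
      Finset.sum_add_distrib, ← Finset.sum_mul, hsum]
    ring
  have key : f 0 ≤ ∑ i, p i * Real.log (p i) - ∑ j, P j * Real.log (P j) := by
    refine ge_of_tendsto hflim ?_
    filter_upwards [eventually_ge_atTop 0] with s hs
    exact hmono Set.self_mem_Ici hs hs
  simp only [hf, zero_mul, add_zero] at key
  simp only [mul_sub, Finset.sum_sub_distrib]
  linarith

namespace Matrix

section Trace

variable {ι κ : Type*} [Fintype ι] [Fintype κ]

theorem re_trace_mul_unitary_diagonal [DecidableEq ι] (X U : Matrix ι ι ℂ) (a : ι → ℝ) :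
    ((X * (U * diagonal (fun i => (a i : ℂ)) * Uᴴ)).trace).re =
      ∑ i, a i * ((Uᴴ * X * U) i i).re := by
  have : (X * (U * diagonal (fun i => (a i : ℂ)) * Uᴴ)).trace =
      ((Uᴴ * X * U) * diagonal (fun i => (a i : ℂ))).trace := by
    rw [← Matrix.mul_assoc, trace_mul_comm]
    simp only [Matrix.mul_assoc]
  rw [this, trace, Complex.re_sum]
  refine Finset.sum_congr rfl fun i _ => ?_
  rw [diag_apply, mul_diagonal, Complex.re_mul_ofReal, mul_comm]

theorem IsHermitian.eq_unitary_diagonal [DecidableEq ι] {A : Matrix ι ι ℂ} (hA : A.IsHermitian) :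
    A = (hA.eigenvectorUnitary : Matrix ι ι ℂ) * diagonal (fun i => (hA.eigenvalues i : ℂ)) *
      (hA.eigenvectorUnitary : Matrix ι ι ℂ)ᴴ := by
  have h := hA.spectral_theorem
  rw [Unitary.conjStarAlgAut_apply] at h
  exact h

theorem PosSemidef.re_trace_mul_nonneg [DecidableEq ι] {A B : Matrix ι ι ℂ}
    (hA : A.PosSemidef) (hB : B.PosSemidef) : 0 ≤ ((A * B).trace).re := by
  rw [hB.1.eq_unitary_diagonal, re_trace_mul_unitary_diagonal]
  refine Finset.sum_nonneg fun i _ => mul_nonneg (hB.eigenvalues_nonneg i) ?_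
  exact (Complex.le_def.1 (hA.conjTranspose_mul_mul_same _).diag_nonneg).1

omit [Fintype ι] in
theorem mul_conjTranspose_self_apply_re (M : Matrix ι κ ℂ) (i : ι) :
    ((M * Mᴴ) i i).re = ∑ j, ‖M i j‖ ^ 2 := by
  simp [mul_apply, Complex.re_sum, Complex.mul_conj, Complex.normSq_eq_norm_sq, -Complex.ofReal_pow]

omit [Fintype κ] in
theorem conjTranspose_mul_self_apply_re (M : Matrix ι κ ℂ) (j : κ) :
    ((Mᴴ * M) j j).re = ∑ i, ‖M i j‖ ^ 2 := by
  simpa using mul_conjTranspose_self_apply_re Mᴴ j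

/-- For a POVM `E` and weights `x`, the operator `X = ∑ x E` satisfies `X² ≤ ∑ x² E`, here tested
against a positive semidefinite matrix. -/
theorem re_trace_sq_mul_le_of_povm [DecidableEq ι] {E : κ → Matrix ι ι ℂ}
    (hE : ∀ ω, (E ω).PosSemidef) (hE1 : ∑ ω, E ω = 1) (x : κ → ℝ) {ρ : Matrix ι ι ℂ}
    (hρ : ρ.PosSemidef) :
    ((((∑ ω, x ω • E ω) * ∑ ω, x ω • E ω) * ρ).trace).re ≤
      ∑ ω, x ω ^ 2 * ((E ω * ρ).trace).re := by
  set X := ∑ ω, x ω • E ω with hX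
  have hXh : Xᴴ = X := by
    simp only [hX, conjTranspose_sum, conjTranspose_smul, (hE _).1.eq, star_trivial]
  have h1 : ∑ ω, (x ω • (1 : Matrix ι ι ℂ) - X) * E ω * (x ω • (1 : Matrix ι ι ℂ) - X) =
      ∑ ω, x ω ^ 2 • E ω - X * X := by
    have h2 : ∀ ω, (x ω • (1 : Matrix ι ι ℂ) - X) * E ω * (x ω • (1 : Matrix ι ι ℂ) - X) =
        x ω ^ 2 • E ω - (x ω • E ω) * X - X * (x ω • E ω) + X * E ω * X := by
      intro ω
      simp only [sub_mul, mul_sub, smul_mul_assoc, mul_smul_comm, Matrix.one_mul, Matrix.mul_one,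
        smul_sub, smul_smul, sq]
      abel
    simp only [h2, Finset.sum_add_distrib, Finset.sum_sub_distrib, ← Finset.sum_mul,
      ← Finset.mul_sum, hE1, ← hX, Matrix.mul_one]
    abel
  have h3 : 0 ≤ (((∑ ω, x ω ^ 2 • E ω - X * X) * ρ).trace).re := by
    rw [← h1]
    refine PosSemidef.re_trace_mul_nonneg (posSemidef_sum _ fun ω _ => ?_) hρ
    have h4 := (hE ω).mul_mul_conjTranspose_same (x ω • (1 : Matrix ι ι ℂ) - X)
    rwa [conjTranspose_sub, conjTranspose_smul, conjTranspose_one, star_trivial, hXh] at h4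
  rw [sub_mul, trace_sub, Complex.sub_re, sub_nonneg] at h3
  refine h3.trans_eq ?_
  simp [Finset.sum_mul, trace_sum, Complex.re_sum, -Complex.real_smul, Complex.smul_re]

/-- Variational lower bound for the quadratic form of the resolvent of the relative modular
operator of `U diag(a) Uᴴ` and `W diag(b) Wᴴ`. -/
theorem two_mul_re_trace_sub_le_sum [DecidableEq ι] {U W X : Matrix ι ι ℂ} {a b : ι → ℝ}
    (hU : U * Uᴴ = 1) (hW : W * Wᴴ = 1) (hX : X.IsHermitian)
    (ha : ∀ i, 0 ≤ a i) (hb : ∀ i, 0 ≤ b i) {s : ℝ} (hs : 0 < s) :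
    2 * ((X * (U * diagonal (fun i => (a i : ℂ)) * Uᴴ)).trace).re
      - ((X * X * (W * diagonal (fun i => (b i : ℂ)) * Wᴴ)).trace).re
      - s * ((X * X * (U * diagonal (fun i => (a i : ℂ)) * Uᴴ)).trace).re ≤
    ∑ i, ∑ j, (a i * ‖(Uᴴ * W) i j‖ ^ 2) ^ 2 /
      (b j * ‖(Uᴴ * W) i j‖ ^ 2 + s * (a i * ‖(Uᴴ * W) i j‖ ^ 2)) := by
  set N := Uᴴ * W with hN
  set M := Uᴴ * X * W with hM
  have e1 : Uᴴ * X * U = M * Nᴴ := by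
    rw [hM, hN, conjTranspose_mul, conjTranspose_conjTranspose, Matrix.mul_assoc _ W,
      ← Matrix.mul_assoc W, hW, Matrix.one_mul]
  have e2 : Wᴴ * (X * X) * W = Mᴴ * M := by
    simp only [hM, conjTranspose_mul, conjTranspose_conjTranspose, hX.eq, Matrix.mul_assoc]
    rw [← Matrix.mul_assoc U, hU, Matrix.one_mul]
  have e3 : Uᴴ * (X * X) * U = M * Mᴴ := by
    simp only [hM, conjTranspose_mul, conjTranspose_conjTranspose, hX.eq, Matrix.mul_assoc]
    rw [← Matrix.mul_assoc W, hW, Matrix.one_mul]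
  rw [re_trace_mul_unitary_diagonal, re_trace_mul_unitary_diagonal, re_trace_mul_unitary_diagonal,
    e1, e2, e3]
  simp only [mul_conjTranspose_self_apply_re, conjTranspose_mul_self_apply_re]
  have e4 : ∀ i, ((M * Nᴴ) i i).re = ∑ j, (M i j * star (N i j)).re := fun i => by
    simp [mul_apply, Complex.re_sum]
  simp only [e4, Finset.mul_sum]
  rw [Finset.sum_comm (f := fun j i => b j * ‖M i j‖ ^ 2), ← Finset.sum_sub_distrib,
    ← Finset.sum_sub_distrib]
  refine Finset.sum_le_sum fun i _ => ?_
  rw [← Finset.sum_sub_distrib, ← Finset.sum_sub_distrib]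
  refine Finset.sum_le_sum fun j _ => ?_
  have h1 : (M i j * star (N i j)).re ≤ ‖M i j‖ * ‖N i j‖ := by
    simpa using Complex.re_le_norm (M i j * star (N i j))
  have h2 := mul_le_mul_of_nonneg_left h1 (ha i)
  rcases (norm_nonneg (N i j)).eq_or_lt with h0 | hN0
  · rw [norm_eq_zero.1 h0.symm]
    have := mul_nonneg (hb j) (sq_nonneg ‖M i j‖)
    have := mul_nonneg hs.le (mul_nonneg (ha i) (sq_nonneg ‖M i j‖))
    norm_num
    linarith
  rcases (ha i).eq_or_lt with h0 | ha0
  · simp only [← h0]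
    have := mul_nonneg (hb j) (sq_nonneg ‖M i j‖)
    norm_num
    linarith
  have hd : 0 < b j + s * a i := by have := hb j; positivity
  have h3 : (a i * ‖N i j‖ ^ 2) ^ 2 / (b j * ‖N i j‖ ^ 2 + s * (a i * ‖N i j‖ ^ 2)) =
      (a i * ‖N i j‖) ^ 2 / (b j + s * a i) := by
    rw [div_eq_div_iff (by have := hb j; positivity) hd.ne']
    ring
  rw [h3, le_div_iff₀ hd]
  nlinarith [sq_nonneg (a i * ‖N i j‖ - (b j + s * a i) * ‖M i j‖)]

end Trace

end Matrix

/-- Measuring a POVM does not increase the relative entropy. -/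
theorem sum_povm_mul_log_sub_log_le_relEnt {ι κ : Type*} [Fintype ι] [DecidableEq ι] [Fintype κ]
    {E : κ → Matrix ι ι ℂ} (hE : ∀ ω, (E ω).PosSemidef) (hE1 : ∑ ω, E ω = 1)
    {σ τ : Matrix ι ι ℂ} (hσ : σ.PosSemidef) (hτ : τ.PosSemidef) {c : ℝ} (hc : 0 < c)
    (hle : (τ - c • σ).PosSemidef) :
    ∑ ω, ((E ω * σ).trace).re *
      (Real.log ((E ω * σ).trace).re - Real.log ((E ω * τ).trace).re) ≤ relEnt σ τ := by
  set U : Matrix ι ι ℂ := (hσ.1.eigenvectorUnitary : Matrix ι ι ℂ) with hU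
  set W : Matrix ι ι ℂ := (hτ.1.eigenvectorUnitary : Matrix ι ι ℂ) with hW
  set a := hσ.1.eigenvalues with ha
  set b := hτ.1.eigenvalues with hb
  have ha0 : ∀ i, 0 ≤ a i := hσ.eigenvalues_nonneg
  have hb0 : ∀ i, 0 ≤ b i := hτ.eigenvalues_nonneg
  have hUU : U * Uᴴ = 1 := Unitary.coe_mul_star_self hσ.1.eigenvectorUnitary
  have hWW : W * Wᴴ = 1 := Unitary.coe_mul_star_self hτ.1.eigenvectorUnitary
  have hWW' : Wᴴ * W = 1 := Unitary.coe_star_mul_self hτ.1.eigenvectorUnitary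
  have hUU' : Uᴴ * U = 1 := Unitary.coe_star_mul_self hσ.1.eigenvectorUnitary
  have hσe : σ = U * diagonal (fun i => (a i : ℂ)) * Uᴴ := hσ.1.eq_unitary_diagonal
  have hτe : τ = W * diagonal (fun i => (b i : ℂ)) * Wᴴ := hτ.1.eq_unitary_diagonal
  set N := Uᴴ * W with hN
  have hrow : ∀ i, ∑ j, ‖N i j‖ ^ 2 = 1 := fun i => by
    have h1 : N * Nᴴ = 1 := by
      rw [hN, conjTranspose_mul, conjTranspose_conjTranspose, Matrix.mul_assoc,
        ← Matrix.mul_assoc W, hWW, Matrix.one_mul, hUU']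
    rw [← mul_conjTranspose_self_apply_re, h1]
    simp
  have hWσ : ∀ j, ((Wᴴ * σ * W) j j).re = ∑ i, a i * ‖N i j‖ ^ 2 := fun j => by
    have h1 : Wᴴ * σ * W = Nᴴ * diagonal (fun i => (a i : ℂ)) * N := by
      rw [hN, conjTranspose_mul, conjTranspose_conjTranspose, hσe]
      simp only [Matrix.mul_assoc]
    rw [h1, mul_apply, Complex.re_sum]
    refine Finset.sum_congr rfl fun i _ => ?_
    rw [mul_diagonal, conjTranspose_apply, mul_right_comm, Complex.re_mul_ofReal, mul_comm (a i)]
    congr 1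
    rw [mul_comm, Complex.star_def, Complex.mul_conj, Complex.ofReal_re,
      Complex.normSq_eq_norm_sq]
  have hWτ : ∀ j, ((Wᴴ * τ * W) j j).re = b j := fun j => by
    have h1 : Wᴴ * τ * W = diagonal (fun i => (b i : ℂ)) := by
      rw [hτe]
      simp only [Matrix.mul_assoc, hWW', Matrix.mul_one]
      rw [← Matrix.mul_assoc, hWW', Matrix.one_mul]
    rw [h1]
    simp
  have hmarg : ∀ j, c * ∑ i, a i * ‖N i j‖ ^ 2 ≤ b j := fun j => by
    have h1 := (Complex.le_def.1 ((hle.conjTranspose_mul_mul_same W).diag_nonneg (i := j))).1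
    rw [mul_sub, sub_mul, mul_smul_comm, smul_mul_assoc, Matrix.sub_apply, Matrix.smul_apply,
      Complex.sub_re, Complex.smul_re, hWσ, hWτ] at h1
    simpa using h1
  have hmarg' : ∀ i j, c * (a i * ‖N i j‖ ^ 2) ≤ b j := fun i j =>
    (mul_le_mul_of_nonneg_left (Finset.single_le_sum (f := fun i => a i * ‖N i j‖ ^ 2)
      (fun i _ => mul_nonneg (ha0 i) (sq_nonneg _)) (Finset.mem_univ i)) hc.le).trans (hmarg j)
  have hsupp : ∀ i j, 0 < a i * ‖N i j‖ ^ 2 → 0 < b j := fun i j h =>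
    (mul_pos hc h).trans_le (hmarg' i j)
  have hent : relEnt σ τ =
      ∑ x : ι × ι, (a x.1 * ‖N x.1 x.2‖ ^ 2) *
        (Real.log (a x.1 * ‖N x.1 x.2‖ ^ 2) - Real.log (b x.2 * ‖N x.1 x.2‖ ^ 2)) := by
    have hterm : ∀ i j, a i * ‖N i j‖ ^ 2 *
        (Real.log (a i * ‖N i j‖ ^ 2) - Real.log (b j * ‖N i j‖ ^ 2)) =
        a i * Real.log (a i) * ‖N i j‖ ^ 2 - Real.log (b j) * (a i * ‖N i j‖ ^ 2) := by
      intro i j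
      rcases (mul_nonneg (ha0 i) (sq_nonneg ‖N i j‖)).eq_or_lt with h0 | h0
      · rw [mul_right_comm (a i) (Real.log (a i)), ← h0]
        simp
      · have h1 : a i ≠ 0 := left_ne_zero_of_mul h0.ne'
        have h2 : ‖N i j‖ ^ 2 ≠ 0 := right_ne_zero_of_mul h0.ne'
        rw [Real.log_mul h1 h2, Real.log_mul (hsupp i j h0).ne' h2]
        ring
    have hweight : ∀ j, (if 0 < b j then Real.log (b j) *
        ((star (fun i => hτ.1.eigenvectorBasis j i)) ⬝ᵥ
          σ.mulVec (fun i => hτ.1.eigenvectorBasis j i)).re else 0) =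
        ∑ i, Real.log (b j) * (a i * ‖N i j‖ ^ 2) := by
      intro j
      rw [← Finset.mul_sum, ← hWσ]
      have h1 : (Wᴴ * σ * W) j j = (star (fun i => hτ.1.eigenvectorBasis j i)) ⬝ᵥ
          σ.mulVec (fun i => hτ.1.eigenvectorBasis j i) := by
        rw [Matrix.mul_assoc]
        rfl
      rw [h1]
      split_ifs with h0
      · rfl
      · rw [← (hb0 j).eq_of_not_lt h0]
        simp
    rw [relEnt, dif_pos ⟨hσ.1, hτ.1⟩, Finset.sum_congr rfl fun j _ => hweight j,
      Fintype.sum_prod_type]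
    simp only [hterm, Finset.sum_sub_distrib, ← Finset.mul_sum, hrow, mul_one]
    rw [sub_right_inj, Finset.sum_comm]
    simp only [Finset.mul_sum]
  have hEle : ∀ ω, c * ((E ω * σ).trace).re ≤ ((E ω * τ).trace).re := fun ω => by
    have h1 := (hE ω).re_trace_mul_nonneg hle
    rw [mul_sub, mul_smul_comm, trace_sub, trace_smul, Complex.sub_re, Complex.smul_re,
      smul_eq_mul] at h1
    linarith
  rw [hent]
  refine sum_mul_log_sub_log_le_of_sum_sq_div_le
    (fun x => mul_nonneg (ha0 _) (sq_nonneg _)) (fun x => mul_nonneg (hb0 _) (sq_nonneg _))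
    ?_ (fun ω => (hE ω).re_trace_mul_nonneg hσ) (fun ω => (hE ω).re_trace_mul_nonneg hτ) ?_ ?_ ?_
  · intro x hx
    exact mul_pos (hsupp _ _ hx) ((sq_nonneg _).lt_of_ne' (right_ne_zero_of_mul hx.ne'))
  · intro ω hω
    exact (mul_pos hc hω).trans_le (hEle ω)
  · rw [← Complex.re_sum, ← trace_sum, ← Finset.sum_mul, hE1, Matrix.one_mul,
      hσ.1.trace_eq_sum_eigenvalues, Fintype.sum_prod_type]
    simp [← Finset.mul_sum, hrow, Complex.re_sum, ha]
  · intro s hs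
    set x : κ → ℝ := fun ω =>
      ((E ω * σ).trace).re / (((E ω * τ).trace).re + s * ((E ω * σ).trace).re) with hx
    set X := ∑ ω, x ω • E ω with hX
    have hXh : X.IsHermitian := by
      simp only [IsHermitian, hX, conjTranspose_sum, conjTranspose_smul, (hE _).1.eq,
        star_trivial]
    have h1 := two_mul_re_trace_sub_le_sum hUU hWW hXh ha0 hb0 hs
    rw [← hσe, ← hτe] at h1
    have h2 : ((X * σ).trace).re = ∑ ω, x ω * ((E ω * σ).trace).re := by
      simp [hX, Finset.sum_mul, trace_sum, Complex.re_sum, -Complex.real_smul, Complex.smul_re]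
    have h3 := re_trace_sq_mul_le_of_povm hE hE1 x hσ
    have h4 := re_trace_sq_mul_le_of_povm hE hE1 x hτ
    rw [Fintype.sum_prod_type]
    refine le_trans ?_ h1
    rw [h2]
    refine le_trans (le_of_eq ?_)
      (sub_le_sub (sub_le_sub le_rfl h4) (mul_le_mul_of_nonneg_left h3 hs.le))
    rw [Finset.mul_sum, Finset.mul_sum, ← Finset.sum_sub_distrib, ← Finset.sum_sub_distrib]
    refine Finset.sum_congr rfl fun ω _ => ?_
    simp only [hx]
    rcases ((hE ω).re_trace_mul_nonneg hσ).eq_or_lt with h0 | h0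
    · simp [← h0]
    · have h5 : 0 < ((E ω * τ).trace).re := (mul_pos hc h0).trans_le (hEle ω)
      field_simp
      ring

theorem holevo_bound {A Ω K : Type*} [Fintype A] [Fintype Ω] [Fintype K]
    [Nonempty A] [Nonempty Ω] [Nonempty K] {n m : ℕ} (hn : 1 ≤ n) (hm : 1 ≤ m)
    (p : A → ℝ) (hp0 : ∀ α, 0 ≤ p α) (hp1 : ∑ α, p α = 1)
    (ρ : A → Matrix (Fin n) (Fin n) ℂ) (hρ : ∀ α, IsDensityMatrix (ρ α))
    (V : Ω → K → Matrix (Fin m) (Fin n) ℂ)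
    (hV : ∑ ω, ∑ k, (V ω k)ᴴ * V ω k = 1)
    (η : Matrix (Fin n) (Fin n) ℂ) (hη : η = ∑ α, p α • ρ α) :
    Ic p ρ V ≤ holevoChi p ρ := by
  subst hη
  have hE : ∀ ω, (povm V ω).PosSemidef := fun ω =>
    posSemidef_sum _ fun k _ => posSemidef_conjTranspose_mul_self _
  have hpρ : ∀ α, (p α • ρ α).PosSemidef := fun α => (hρ α).1.smul (hp0 α)
  have hτ : (∑ β, p β • ρ β).PosSemidef := posSemidef_sum _ fun α _ => hpρ α
  refine Finset.sum_le_sum fun α _ => ?_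
  rcases (hp0 α).eq_or_lt with h0 | h0
  · simp [← h0]
  classical
  have hle : (∑ β, p β • ρ β - p α • ρ α).PosSemidef := by
    rw [← Finset.add_sum_erase _ _ (Finset.mem_univ α), add_sub_cancel_left]
    exact posSemidef_sum _ fun α _ => hpρ α
  rw [if_pos h0]
  refine le_trans (le_of_eq ?_) (mul_le_mul_of_nonneg_left
    (sum_povm_mul_log_sub_log_le_relEnt hE hV (hρ α).1 hτ h0 hle) h0.le)
  rw [Finset.mul_sum]
  refine Finset.sum_congr rfl fun ω _ => ?_
  change _ = p α * (probOut V (ρ α) ω *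
    (Real.log (probOut V (ρ α) ω) - Real.log (probOut V (∑ β, p β • ρ β) ω)))
  have hP : 0 ≤ probOut V (ρ α) ω := (hE ω).re_trace_mul_nonneg (hρ α).1
  rcases hP.eq_or_lt with h1 | h1
  · simp [← h1]
  have h2 : 0 < probOut V (∑ β, p β • ρ β) ω := by
    have h3 := (hE ω).re_trace_mul_nonneg hle
    rw [mul_sub, mul_smul_comm, trace_sub, trace_smul, Complex.sub_re, Complex.smul_re,
      smul_eq_mul, sub_nonneg] at h3
    exact (mul_pos h0 h1).trans_le h3
  rw [if_pos (mul_pos h0 h1), mul_div_mul_left _ _ h0.ne', Real.log_div h1.ne' h2.ne', mul_assoc]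

end
end
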